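/- arXiv:1909.08154 — 7 statements merged into one kernel-verified Lean document; each statement's English description precedes it below -/
import Mathlib

section
/- Let (x₁, x₂, x₃) ∈ ℝ³ satisfy x₁²/a₁ + x₂²/a₂ + x₃²/a₃ < 1 and x₁ ≠ 0, x₂ ≠ 0, x₃ ≠ 0. Then the equation x₁²/(a₁−λ) + x₂²/(a₂−λ) + x₃²/(a₃+λ) = 1 has exactly one solution λ in each of the three intervals (−a₃, 0), (0, a₂), (a₂, a₁), and it has no other solutions in ℝ ∖ {a₁, a₂, −a₃}. In other words, a generic point inside the ellipsoid E lies on exactly three distinct quadrics of the confocal family: two ellipsoids and one 1-sheeted hyperboloid oriented along the x₂-axis. -/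
/-- A monic cubic with three distinct roots `r`, `s`, `t` has no further roots. -/
theorem eq_or_eq_or_eq_of_monic_cubic_roots {K : Type*} [Field K] {b c d r s t l : K}
    (hrs : r ≠ s) (hrt : r ≠ t) (hst : s ≠ t)
    (hr : r ^ 3 + b * r ^ 2 + c * r + d = 0) (hs : s ^ 3 + b * s ^ 2 + c * s + d = 0)
    (ht : t ^ 3 + b * t ^ 2 + c * t + d = 0) (hl : l ^ 3 + b * l ^ 2 + c * l + d = 0) :
    l = r ∨ l = s ∨ l = t := by
  have quotient_root {u : K} (hur : r ≠ u) (hu : u ^ 3 + b * u ^ 2 + c * u + d = 0) :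
      u ^ 2 + u * r + r ^ 2 + b * (u + r) + c = 0 :=
    mul_left_cancel₀ (sub_ne_zero.2 hur) (by linear_combination hr - hu)
  have sum_roots {u : K} (hur : r ≠ u) (hus : s ≠ u)
      (hu : u ^ 3 + b * u ^ 2 + c * u + d = 0) : u + r + s + b = 0 :=
    mul_left_cancel₀ (sub_ne_zero.2 hus)
      (by linear_combination quotient_root hrs hs - quotient_root hur hu)
  by_cases hlr : l = r
  · exact Or.inl hlr
  by_cases hls : l = s
  · exact Or.inr (Or.inl hls)
  refine Or.inr (Or.inr ?_)
  linear_combination sum_roots (Ne.symm hlr) (Ne.symm hls) hl - sum_roots hrt hst ht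

/-- The confocal equation with denominators cleared, as a polynomial in the parameter. -/
def confocalCubic (a₁ a₂ a₃ x₁ x₂ x₃ l : ℝ) : ℝ :=
  (a₁ - l) * (a₂ - l) * (a₃ + l) - x₁ ^ 2 * ((a₂ - l) * (a₃ + l))
    - x₂ ^ 2 * ((a₁ - l) * (a₃ + l)) - x₃ ^ 2 * ((a₁ - l) * (a₂ - l))

theorem continuous_confocalCubic (a₁ a₂ a₃ x₁ x₂ x₃ : ℝ) :
    Continuous (confocalCubic a₁ a₂ a₃ x₁ x₂ x₃) := by
  unfold confocalCubic
  fun_prop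

theorem confocalCubic_eq_zero_iff {a₁ a₂ a₃ x₁ x₂ x₃ l : ℝ}
    (h₁ : l ≠ a₁) (h₂ : l ≠ a₂) (h₃ : l ≠ -a₃) :
    confocalCubic a₁ a₂ a₃ x₁ x₂ x₃ l = 0 ↔
      x₁ ^ 2 / (a₁ - l) + x₂ ^ 2 / (a₂ - l) + x₃ ^ 2 / (a₃ + l) = 1 := by
  have h₁' : a₁ - l ≠ 0 := sub_ne_zero.2 h₁.symm
  have h₂' : a₂ - l ≠ 0 := sub_ne_zero.2 h₂.symm
  have h₃' : a₃ + l ≠ 0 := fun h => h₃ (by linarith)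
  unfold confocalCubic
  field_simp
  constructor <;> intro h <;> linear_combination -h

theorem eq_or_eq_or_eq_of_confocalCubic_eq_zero {a₁ a₂ a₃ x₁ x₂ x₃ r s t l : ℝ}
    (hrs : r ≠ s) (hrt : r ≠ t) (hst : s ≠ t)
    (hr : confocalCubic a₁ a₂ a₃ x₁ x₂ x₃ r = 0) (hs : confocalCubic a₁ a₂ a₃ x₁ x₂ x₃ s = 0)
    (ht : confocalCubic a₁ a₂ a₃ x₁ x₂ x₃ t = 0) (hl : confocalCubic a₁ a₂ a₃ x₁ x₂ x₃ l = 0) :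
    l = r ∨ l = s ∨ l = t := by
  have expand (u : ℝ) : confocalCubic a₁ a₂ a₃ x₁ x₂ x₃ u =
      u ^ 3 + (a₃ - a₁ - a₂ + x₁ ^ 2 + x₂ ^ 2 - x₃ ^ 2) * u ^ 2
        + (a₁ * a₂ - (a₁ + a₂) * a₃ - x₁ ^ 2 * (a₂ - a₃) - x₂ ^ 2 * (a₁ - a₃)
          + x₃ ^ 2 * (a₁ + a₂)) * u
        + (a₁ * a₂ * a₃ - x₁ ^ 2 * (a₂ * a₃) - x₂ ^ 2 * (a₁ * a₃) - x₃ ^ 2 * (a₁ * a₂)) := by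
    unfold confocalCubic
    ring
  rw [expand] at hr hs ht hl
  exact eq_or_eq_or_eq_of_monic_cubic_roots hrs hrt hst hr hs ht hl

/-- A generic point strictly inside the ellipsoid `E`, with all coordinates nonzero,
lies on exactly one confocal quadric with parameter in each of the intervals
`(−a₃, 0)`, `(0, a₂)`, `(a₂, a₁)`, and on no other quadric of the confocal family. -/
theorem generic_point_on_exactly_three_confocal_quadrics
    (a₁ a₂ a₃ : ℝ) (h12 : a₁ > a₂) (h2 : a₂ > 0) (h3 : a₃ > 0)
    (x₁ x₂ x₃ : ℝ)
    (hin : x₁ ^ 2 / a₁ + x₂ ^ 2 / a₂ + x₃ ^ 2 / a₃ < 1)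
    (hx₁ : x₁ ≠ 0) (hx₂ : x₂ ≠ 0) (hx₃ : x₃ ≠ 0) :
    (∃! l : ℝ, l ∈ Set.Ioo (-a₃) 0 ∧
      x₁ ^ 2 / (a₁ - l) + x₂ ^ 2 / (a₂ - l) + x₃ ^ 2 / (a₃ + l) = 1) ∧
    (∃! l : ℝ, l ∈ Set.Ioo 0 a₂ ∧
      x₁ ^ 2 / (a₁ - l) + x₂ ^ 2 / (a₂ - l) + x₃ ^ 2 / (a₃ + l) = 1) ∧
    (∃! l : ℝ, l ∈ Set.Ioo a₂ a₁ ∧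
      x₁ ^ 2 / (a₁ - l) + x₂ ^ 2 / (a₂ - l) + x₃ ^ 2 / (a₃ + l) = 1) ∧
    (∀ l : ℝ, l ≠ a₁ → l ≠ a₂ → l ≠ -a₃ →
      x₁ ^ 2 / (a₁ - l) + x₂ ^ 2 / (a₂ - l) + x₃ ^ 2 / (a₃ + l) = 1 →
      l ∈ Set.Ioo (-a₃) 0 ∨ l ∈ Set.Ioo 0 a₂ ∨ l ∈ Set.Ioo a₂ a₁) := by
  have ha₁ : 0 < a₁ := h2.trans h12
  have hcont := continuous_confocalCubic a₁ a₂ a₃ x₁ x₂ x₃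
  have neg_at_neg_a₃ : confocalCubic a₁ a₂ a₃ x₁ x₂ x₃ (-a₃) < 0 := by
    have : 0 < x₃ ^ 2 * ((a₁ + a₃) * (a₂ + a₃)) := by positivity
    unfold confocalCubic
    linarith
  have pos_at_zero : 0 < confocalCubic a₁ a₂ a₃ x₁ x₂ x₃ 0 := by
    have h : 0 < a₁ * a₂ * a₃ * (1 - (x₁ ^ 2 / a₁ + x₂ ^ 2 / a₂ + x₃ ^ 2 / a₃)) :=
      mul_pos (by positivity) (sub_pos.2 hin)
    convert h using 1
    unfold confocalCubic
    field_simp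
    ring
  have neg_at_a₂ : confocalCubic a₁ a₂ a₃ x₁ x₂ x₃ a₂ < 0 := by
    have h : 0 < a₁ - a₂ := sub_pos.2 h12
    have : 0 < x₂ ^ 2 * ((a₁ - a₂) * (a₃ + a₂)) := by positivity
    unfold confocalCubic
    linarith
  have pos_at_a₁ : 0 < confocalCubic a₁ a₂ a₃ x₁ x₂ x₃ a₁ := by
    have h : 0 < a₁ - a₂ := sub_pos.2 h12
    have : 0 < x₁ ^ 2 * ((a₁ - a₂) * (a₃ + a₁)) := by positivity
    unfold confocalCubic
    linarith
  obtain ⟨r, ⟨hr₁, hr₂⟩, hr⟩ := intermediate_value_Ioo (neg_nonpos.2 h3.le) hcont.continuousOn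
    ⟨neg_at_neg_a₃, pos_at_zero⟩
  obtain ⟨s, ⟨hs₁, hs₂⟩, hs⟩ := intermediate_value_Ioo' h2.le hcont.continuousOn
    ⟨neg_at_a₂, pos_at_zero⟩
  obtain ⟨t, ⟨ht₁, ht₂⟩, ht⟩ := intermediate_value_Ioo h12.le hcont.continuousOn
    ⟨neg_at_a₂, pos_at_a₁⟩
  have trichotomy (l : ℝ) (h₁ : l ≠ a₁) (h₂ : l ≠ a₂) (h₃ : l ≠ -a₃)
      (hl : x₁ ^ 2 / (a₁ - l) + x₂ ^ 2 / (a₂ - l) + x₃ ^ 2 / (a₃ + l) = 1) :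
      l = r ∨ l = s ∨ l = t :=
    eq_or_eq_or_eq_of_confocalCubic_eq_zero (by linarith : r < s).ne (by linarith : r < t).ne
      (by linarith : s < t).ne hr hs ht ((confocalCubic_eq_zero_iff h₁ h₂ h₃).2 hl)
  refine ⟨⟨r, ⟨⟨hr₁, hr₂⟩, ?_⟩, ?_⟩, ⟨s, ⟨⟨hs₁, hs₂⟩, ?_⟩, ?_⟩, ⟨t, ⟨⟨ht₁, ht₂⟩, ?_⟩, ?_⟩, ?_⟩
  · exact (confocalCubic_eq_zero_iff (by grind) (by grind) (by grind)).1 hr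
  · rintro l ⟨⟨_, _⟩, hl⟩
    rcases trichotomy l (by grind) (by grind) (by grind) hl with h | h | h <;> grind
  · exact (confocalCubic_eq_zero_iff (by grind) (by grind) (by grind)).1 hs
  · rintro l ⟨⟨_, _⟩, hl⟩
    rcases trichotomy l (by grind) (by grind) (by grind) hl with h | h | h <;> grind
  · exact (confocalCubic_eq_zero_iff (by grind) (by grind) (by grind)).1 ht
  · rintro l ⟨⟨_, _⟩, hl⟩
    rcases trichotomy l (by grind) (by grind) (by grind) hl with h | h | h <;> grind
  · intro l h₁ h₂ h₃ hl
    rcases trichotomy l h₁ h₂ h₃ hl with rfl | rfl | rfl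
    · exact Or.inl ⟨hr₁, hr₂⟩
    · exact Or.inr (Or.inl ⟨hs₁, hs₂⟩)
    · exact Or.inr (Or.inr ⟨ht₁, ht₂⟩)
end

section
/- For any P, v ∈ ℝ³ there exists a real polynomial g of degree at most 2 whose coefficient of λ² equals −⟨v,v⟩ = −(v₁² + v₂² − v₃²), such that (a₁−λ)(a₂−λ)(a₃+λ)·Δ_λ(P,v) = g(λ) for every λ ∈ ℝ ∖ {a₁, a₂, −a₃}. -/
/-- The bilinear form `J_λ(u,w) = u₁w₁/(a₁−λ) + u₂w₂/(a₂−λ) + u₃w₃/(a₃+λ)`. -/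
noncomputable def Jform (a₁ a₂ a₃ l : ℝ) (u w : Fin 3 → ℝ) : ℝ :=
  u 0 * w 0 / (a₁ - l) + u 1 * w 1 / (a₂ - l) + u 2 * w 2 / (a₃ + l)

/-- The tangency discriminant `Δ_λ(P,v) = J_λ(P,v)² − J_λ(v,v)(J_λ(P,P) − 1)`. -/
noncomputable def Δdisc (a₁ a₂ a₃ l : ℝ) (P v : Fin 3 → ℝ) : ℝ :=
  (Jform a₁ a₂ a₃ l P v) ^ 2 -
    Jform a₁ a₂ a₃ l v v * (Jform a₁ a₂ a₃ l P P - 1)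

/-- `(a₁−λ)(a₂−λ)(a₃+λ)·Δ_λ(P,v)` is a polynomial in `λ` of degree at most `2`,
whose leading coefficient (the coefficient of `λ²`) is `−⟨v,v⟩`. -/
theorem discriminant_numerator_is_quadratic
    (a₁ a₂ a₃ : ℝ) (h12 : a₁ > a₂) (h2 : a₂ > 0) (h3 : a₃ > 0)
    (P v : Fin 3 → ℝ) :
    ∃ g : Polynomial ℝ, g.degree ≤ 2 ∧
      g.coeff 2 = -(v 0 ^ 2 + v 1 ^ 2 - v 2 ^ 2) ∧
      ∀ l : ℝ, l ≠ a₁ → l ≠ a₂ → l ≠ -a₃ →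
        (a₁ - l) * (a₂ - l) * (a₃ + l) * Δdisc a₁ a₂ a₃ l P v = g.eval l := by
  -- By Lagrange's identity, `Δ = J(v,v) - ∑_{i<j} (Pᵢvⱼ - Pⱼvᵢ)² / (dᵢdⱼ)`.
  refine ⟨Polynomial.C (-(v 0 ^ 2 + v 1 ^ 2 - v 2 ^ 2)) * Polynomial.X ^ 2 +
    Polynomial.C (v 0 ^ 2 * (a₂ - a₃) + v 1 ^ 2 * (a₁ - a₃) - v 2 ^ 2 * (a₁ + a₂)
      - (P 0 * v 1 - P 1 * v 0) ^ 2 + (P 0 * v 2 - P 2 * v 0) ^ 2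
      + (P 1 * v 2 - P 2 * v 1) ^ 2) * Polynomial.X +
    Polynomial.C (v 0 ^ 2 * (a₂ * a₃) + v 1 ^ 2 * (a₁ * a₃) + v 2 ^ 2 * (a₁ * a₂)
      - (P 0 * v 1 - P 1 * v 0) ^ 2 * a₃ - (P 0 * v 2 - P 2 * v 0) ^ 2 * a₂
      - (P 1 * v 2 - P 2 * v 1) ^ 2 * a₁), Polynomial.degree_quadratic_le, ?_, ?_⟩
  · simp only [Polynomial.coeff_add, Polynomial.coeff_C_mul, Polynomial.coeff_X_pow,
      Polynomial.coeff_X, Polynomial.coeff_C]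
    norm_num
  · intro l hl₁ hl₂ hl₃
    have hd₁ : a₁ - l ≠ 0 := sub_ne_zero.mpr hl₁.symm
    have hd₂ : a₂ - l ≠ 0 := sub_ne_zero.mpr hl₂.symm
    have hd₃ : a₃ + l ≠ 0 := fun h => hl₃ (by linarith)
    simp only [Polynomial.eval_add, Polynomial.eval_mul, Polynomial.eval_C,
      Polynomial.eval_pow, Polynomial.eval_X, Δdisc, Jform]
    field_simp
    ring
end

section
/- Let P, v ∈ ℝ³ with ⟨v,v⟩ = v₁² + v₂² − v₃² ≠ 0 (i.e., the line t ↦ P + tv is space-like or time-like). Then the set {λ ∈ ℝ ∖ {a₁, a₂, −a₃} : Δ_λ(P,v) = 0} of parameters of confocal quadrics tangent to the line has at most two elements. -/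
/-- Clearing denominators turns the tangency condition into a quadratic equation in the parameter,
with leading coefficient `-⟨v,v⟩`. -/
theorem mul_Δdisc (a₁ a₂ a₃ l : ℝ) (P v : Fin 3 → ℝ)
    (h₁ : l ≠ a₁) (h₂ : l ≠ a₂) (h₃ : l ≠ -a₃) :
    (a₁ - l) * (a₂ - l) * (a₃ + l) * Δdisc a₁ a₂ a₃ l P v =
      v 0 ^ 2 * (a₂ - l) * (a₃ + l) + v 1 ^ 2 * (a₁ - l) * (a₃ + l) +
        v 2 ^ 2 * (a₁ - l) * (a₂ - l) - (P 0 * v 1 - P 1 * v 0) ^ 2 * (a₃ + l) -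
        (P 0 * v 2 - P 2 * v 0) ^ 2 * (a₂ - l) - (P 1 * v 2 - P 2 * v 1) ^ 2 * (a₁ - l) := by
  have d₁ : a₁ - l ≠ 0 := sub_ne_zero.mpr h₁.symm
  have d₂ : a₂ - l ≠ 0 := sub_ne_zero.mpr h₂.symm
  have d₃ : a₃ + l ≠ 0 := fun h => h₃ (by linarith)
  unfold Δdisc Jform
  generalize a₁ - l = x at *
  generalize a₂ - l = y at *
  generalize a₃ + l = z at *
  field_simp
  ring

/-- A quadratic equation over a field has at most two solutions. -/
theorem encard_le_two_of_quadratic {K : Type*} [Field K] {A B C : K} (hA : A ≠ 0) {s : Set K}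
    (hs : ∀ x ∈ s, A * x ^ 2 + B * x + C = 0) : s.encard ≤ 2 := by
  by_contra! h
  obtain ⟨t, hts, ht⟩ := Set.exists_subset_encard_eq (k := 3) (Order.add_one_le_of_lt h)
  obtain ⟨x, y, z, hxy, hxz, hyz, rfl⟩ := Set.encard_eq_three.mp ht
  have hx : x ∈ s := hts (by simp)
  have hy : y ∈ s := hts (by simp)
  have hz : z ∈ s := hts (by simp)
  have e₁ : A * (x + y) + B = 0 := mul_left_cancel₀ (sub_ne_zero.mpr hxy) (by
    linear_combination hs x hx - hs y hy)
  have e₂ : A * (x + z) + B = 0 := mul_left_cancel₀ (sub_ne_zero.mpr hxz) (by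
    linear_combination hs x hx - hs z hz)
  have e₃ : A * (y - z) = 0 := by linear_combination e₁ - e₂
  exact mul_ne_zero hA (sub_ne_zero.mpr hyz) e₃

/-- A space-like or time-like line is tangent to at most two quadrics of the
confocal family. -/
theorem nonlightlike_line_tangent_to_at_most_two_quadrics
    (a₁ a₂ a₃ : ℝ) (h12 : a₁ > a₂) (h2 : a₂ > 0) (h3 : a₃ > 0)
    (P v : Fin 3 → ℝ) (hv : v 0 ^ 2 + v 1 ^ 2 - v 2 ^ 2 ≠ 0) :
    {l : ℝ | l ≠ a₁ ∧ l ≠ a₂ ∧ l ≠ -a₃ ∧ Δdisc a₁ a₂ a₃ l P v = 0}.encard ≤ 2 := by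
  refine encard_le_two_of_quadratic (A := -(v 0 ^ 2 + v 1 ^ 2 - v 2 ^ 2))
    (B := v 0 ^ 2 * (a₂ - a₃) + v 1 ^ 2 * (a₁ - a₃) - v 2 ^ 2 * (a₁ + a₂) -
      (P 0 * v 1 - P 1 * v 0) ^ 2 + (P 0 * v 2 - P 2 * v 0) ^ 2 + (P 1 * v 2 - P 2 * v 1) ^ 2)
    (C := v 0 ^ 2 * a₂ * a₃ + v 1 ^ 2 * a₁ * a₃ + v 2 ^ 2 * a₁ * a₂ -
      (P 0 * v 1 - P 1 * v 0) ^ 2 * a₃ - (P 0 * v 2 - P 2 * v 0) ^ 2 * a₂ -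
      (P 1 * v 2 - P 2 * v 1) ^ 2 * a₁) (neg_ne_zero.mpr hv) ?_
  rintro l ⟨h₁, h₂, h₃, hl⟩
  have h := mul_Δdisc a₁ a₂ a₃ l P v h₁ h₂ h₃
  rw [hl, mul_zero] at h
  linear_combination -h
end

section
/- Let P, v ∈ ℝ³ with v ≠ 0 and ⟨v,v⟩ = v₁² + v₂² − v₃² = 0 (i.e., the line t ↦ P + tv is light-like). Then the set {λ ∈ ℝ ∖ {a₁, a₂, −a₃} : Δ_λ(P,v) = 0} is either all of ℝ ∖ {a₁, a₂, −a₃} or has at most one element; i.e., a non-degenerate light-like line is tangent to at most one quadric of the confocal family with finite parameter. -/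
/-- Along a light-like direction, clearing denominators in the tangency discriminant leaves an
affine function of the parameter. -/
theorem exists_affine_eq_Δdisc_mul_of_lightlike (a₁ a₂ a₃ : ℝ) (P v : Fin 3 → ℝ)
    (hlight : v 0 ^ 2 + v 1 ^ 2 - v 2 ^ 2 = 0) :
    ∃ c d : ℝ, ∀ l : ℝ, l ≠ a₁ → l ≠ a₂ → l ≠ -a₃ →
      Δdisc a₁ a₂ a₃ l P v * ((a₁ - l) * (a₂ - l) * (a₃ + l)) = c + d * l := by
  refine ⟨v 0 ^ 2 * a₂ * a₃ + v 1 ^ 2 * a₁ * a₃ + v 2 ^ 2 * a₁ * a₂ -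
      ((P 0 * v 1 - P 1 * v 0) ^ 2 * a₃ + (P 0 * v 2 - P 2 * v 0) ^ 2 * a₂ +
        (P 1 * v 2 - P 2 * v 1) ^ 2 * a₁),
    v 0 ^ 2 * (a₂ - a₃) + v 1 ^ 2 * (a₁ - a₃) - v 2 ^ 2 * (a₁ + a₂) -
      (P 0 * v 1 - P 1 * v 0) ^ 2 + (P 0 * v 2 - P 2 * v 0) ^ 2 +
        (P 1 * v 2 - P 2 * v 1) ^ 2, fun l h₁ h₂ h₃ => ?_⟩
  have hA : a₁ - l ≠ 0 := sub_ne_zero.mpr h₁.symm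
  have hB : a₂ - l ≠ 0 := sub_ne_zero.mpr h₂.symm
  have hC : a₃ + l ≠ 0 := fun h => h₃ (by linarith)
  have key : Δdisc a₁ a₂ a₃ l P v * ((a₁ - l) * (a₂ - l) * (a₃ + l)) =
      v 0 ^ 2 * (a₂ - l) * (a₃ + l) + v 1 ^ 2 * (a₁ - l) * (a₃ + l) +
        v 2 ^ 2 * (a₁ - l) * (a₂ - l) -
      ((P 0 * v 1 - P 1 * v 0) ^ 2 * (a₃ + l) + (P 0 * v 2 - P 2 * v 0) ^ 2 * (a₂ - l) +
        (P 1 * v 2 - P 2 * v 1) ^ 2 * (a₁ - l)) := by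
    unfold Δdisc Jform
    generalize a₁ - l = A at *
    generalize a₂ - l = B at *
    generalize a₃ + l = C at *
    field_simp
    ring
  rw [key]
  linear_combination -l ^ 2 * hlight

/-- The set of parameters of confocal quadrics tangent to a light-like line is
either the whole parameter space `ℝ ∖ {a₁, a₂, −a₃}` or contains at most one
element. -/
theorem lightlike_line_tangent_to_at_most_one_quadric
    (a₁ a₂ a₃ : ℝ) (h12 : a₁ > a₂) (h2 : a₂ > 0) (h3 : a₃ > 0)
    (P v : Fin 3 → ℝ) (hv0 : v ≠ 0)
    (hlight : v 0 ^ 2 + v 1 ^ 2 - v 2 ^ 2 = 0) :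
    {l : ℝ | l ≠ a₁ ∧ l ≠ a₂ ∧ l ≠ -a₃ ∧ Δdisc a₁ a₂ a₃ l P v = 0} =
        {l : ℝ | l ≠ a₁ ∧ l ≠ a₂ ∧ l ≠ -a₃} ∨
      {l : ℝ | l ≠ a₁ ∧ l ≠ a₂ ∧ l ≠ -a₃ ∧ Δdisc a₁ a₂ a₃ l P v = 0}.encard ≤ 1 := by
  obtain ⟨c, d, h⟩ := exists_affine_eq_Δdisc_mul_of_lightlike a₁ a₂ a₃ P v hlight
  rw [or_iff_not_imp_right, Set.encard_le_one_iff]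
  intro hne
  push Not at hne
  obtain ⟨x, y, ⟨hx₁, hx₂, hx₃, hx⟩, ⟨hy₁, hy₂, hy₃, hy⟩, hxy⟩ := hne
  have ex := h x hx₁ hx₂ hx₃
  have ey := h y hy₁ hy₂ hy₃
  rw [hx, zero_mul] at ex
  rw [hy, zero_mul] at ey
  have hd : d = 0 :=
    (mul_eq_zero.mp (by linear_combination ey - ex : d * (x - y) = 0)).resolve_right
      (sub_ne_zero.mpr hxy)
  have hc : c = 0 := by rw [hd] at ex; linarith
  ext l
  refine ⟨fun hl => ⟨hl.1, hl.2.1, hl.2.2.1⟩, fun ⟨h₁, h₂, h₃⟩ => ⟨h₁, h₂, h₃, ?_⟩⟩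
  have el := h l h₁ h₂ h₃
  rw [hc, hd, zero_mul, add_zero] at el
  have hC : a₃ + l ≠ 0 := fun h => h₃ (by linarith)
  exact (mul_eq_zero.mp el).resolve_right
    (mul_ne_zero (mul_ne_zero (sub_ne_zero.mpr h₁.symm) (sub_ne_zero.mpr h₂.symm)) hC)
end

section
/- (Chasles theorem for billiard reflection off the ellipsoid.) Let P ∈ ℝ³ lie on the ellipsoid E, i.e., P₁²/a₁ + P₂²/a₂ + P₃²/a₃ = 1, let n = (P₁/a₁, P₂/a₂, −P₃/a₃) be the Minkowski normal to E at P, and assume ⟨n,n⟩ ≠ 0. Let v ∈ ℝ³ and let v' = v − 2(⟨v,n⟩/⟨n,n⟩)·n be the billiard reflection of v at P. Then for every λ ∈ ℝ ∖ {a₁, a₂, −a₃}: Δ_λ(P,v) = 0 if and only if Δ_λ(P,v') = 0; i.e., the incoming and reflected segments of a billiard trajectory within E are tangent to the same quadrics of the confocal family. -/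
/-- The Minkowski scalar product on `ℝ³`: `⟨X,Y⟩ = X₁Y₁ + X₂Y₂ − X₃Y₃`. -/
def mink (x y : Fin 3 → ℝ) : ℝ := x 0 * y 0 + x 1 * y 1 - x 2 * y 2

/-- At a point of the ellipsoid with Minkowski normal `n`, the discriminant depends on the direction
only through `⟨v,n⟩` and the restriction of `J_λ` to the span of `v` and `n`. -/
theorem Δdisc_eq_of_mem_ellipsoid {a₁ a₂ a₃ l : ℝ} (h1 : a₁ ≠ 0) (h2 : a₂ ≠ 0) (h3 : a₃ ≠ 0)
    (hl1 : a₁ - l ≠ 0) (hl2 : a₂ - l ≠ 0) (hl3 : a₃ + l ≠ 0) {P n : Fin 3 → ℝ}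
    (hP : P 0 ^ 2 / a₁ + P 1 ^ 2 / a₂ + P 2 ^ 2 / a₃ = 1)
    (hn : n = ![P 0 / a₁, P 1 / a₂, -(P 2 / a₃)]) (v : Fin 3 → ℝ) :
    Δdisc a₁ a₂ a₃ l P v =
      (mink v n + l * Jform a₁ a₂ a₃ l v n) ^ 2 -
        Jform a₁ a₂ a₃ l v v * (l * (mink n n + l * Jform a₁ a₂ a₃ l n n)) := by
  have hPv : Jform a₁ a₂ a₃ l P v = mink v n + l * Jform a₁ a₂ a₃ l v n := by
    subst hn
    simp only [Jform, mink, Matrix.cons_val]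
    field_simp
    ring
  have hPP : Jform a₁ a₂ a₃ l P P - 1 = l * (mink n n + l * Jform a₁ a₂ a₃ l n n) := by
    rw [← hP]
    subst hn
    simp only [Jform, mink, Matrix.cons_val]
    field_simp
    ring
  rw [Δdisc, hPv, hPP]

theorem mink_sub_smul_left (v n : Fin 3 → ℝ) (c : ℝ) :
    mink (v - c • n) n = mink v n - c * mink n n := by
  simp only [mink, Pi.sub_apply, Pi.smul_apply, smul_eq_mul]
  ring

theorem Jform_sub_smul_left (a₁ a₂ a₃ l : ℝ) (v n : Fin 3 → ℝ) (c : ℝ) :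
    Jform a₁ a₂ a₃ l (v - c • n) n =
      Jform a₁ a₂ a₃ l v n - c * Jform a₁ a₂ a₃ l n n := by
  simp only [Jform, Pi.sub_apply, Pi.smul_apply, smul_eq_mul]
  ring

theorem Jform_sub_smul_self (a₁ a₂ a₃ l : ℝ) (v n : Fin 3 → ℝ) (c : ℝ) :
    Jform a₁ a₂ a₃ l (v - c • n) (v - c • n) =
      Jform a₁ a₂ a₃ l v v - 2 * c * Jform a₁ a₂ a₃ l v n + c ^ 2 * Jform a₁ a₂ a₃ l n n := by
  simp only [Jform, Pi.sub_apply, Pi.smul_apply, smul_eq_mul]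
  ring

/-- Chasles theorem for the billiard reflection off the ellipsoid: the incoming
and reflected directions at a point of the ellipsoid are tangent to the same
quadrics of the confocal family. -/
theorem chasles_billiard_reflection_preserves_caustics
    (a₁ a₂ a₃ : ℝ) (h12 : a₁ > a₂) (h2 : a₂ > 0) (h3 : a₃ > 0)
    (P : Fin 3 → ℝ)
    (hP : P 0 ^ 2 / a₁ + P 1 ^ 2 / a₂ + P 2 ^ 2 / a₃ = 1)
    (n : Fin 3 → ℝ)
    (hndef : n = ![P 0 / a₁, P 1 / a₂, -(P 2 / a₃)])
    (hn : mink n n ≠ 0)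
    (v v' : Fin 3 → ℝ)
    (hv' : v' = v - (2 * (mink v n / mink n n)) • n) :
    ∀ l : ℝ, l ≠ a₁ → l ≠ a₂ → l ≠ -a₃ →
      (Δdisc a₁ a₂ a₃ l P v = 0 ↔ Δdisc a₁ a₂ a₃ l P v' = 0) := by
  intro l hl1 hl2 hl3
  have hdisc := Δdisc_eq_of_mem_ellipsoid (h2.trans h12).ne' h2.ne' h3.ne'
    (sub_ne_zero.mpr hl1.symm) (sub_ne_zero.mpr hl2.symm)
    (fun h => hl3 (eq_neg_of_add_eq_zero_right h)) hP hndef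
  suffices h : Δdisc a₁ a₂ a₃ l P v' = Δdisc a₁ a₂ a₃ l P v by rw [h]
  rw [hdisc, hdisc, hv', mink_sub_smul_left, Jform_sub_smul_left, Jform_sub_smul_self]
  field_simp
  ring
end

section
/- (Pell equation for periodic trajectories.) Let D(s) = s(s − 1/a₁)(s − 1/a₂)(s + 1/a₃)(s − 1/γ₁)(s − 1/γ₂) and let n ≥ 4. Suppose one of the following holds: (i) n = 2m and there exist real polynomials p, q of degrees exactly m and m−3 with p² − D q² = 1; (ii) n = 2m and there exist real polynomials p, q of degrees exactly m−1 and m−2 with (s − 1/γ₁)(s − 1/γ₂)p² − s(s − 1/a₁)(s − 1/a₂)(s + 1/a₃)q² = ε; (iii) n = 2m+1 and there exist real polynomials p, q of degrees exactly m and m−2 with (s − 1/γ₁)p² − s(s − 1/a₁)(s − 1/a₂)(s + 1/a₃)(s − 1/γ₂)q² = −1; (iv) n = 2m+1 and there exist real polynomials p, q of degrees exactly m and m−2 with (s − 1/γ₂)p² − s(s − 1/a₁)(s − 1/a₂)(s + 1/a₃)(s − 1/γ₁)q² = 1. Then there exist real polynomials p̂ and q̂, of degrees exactly n and n−3 respectively,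 satisfying the Pell equation p̂(s)² − D(s)·q̂(s)² = 1. -/
open Polynomial in
/-- In a solution of the Pell equation with nonconstant `P`, the degree of `P` determines
that of `Q`. -/
theorem degree_of_pell {K : Type*} [Field K] {D P Q : K[X]} {n k : ℕ} (hn : 0 < n)
    (hP : P.natDegree = n) (hD : D.natDegree = 2 * k) (h : P ^ 2 - D * Q ^ 2 = 1) :
    Q.degree = ((n - k : ℕ) : WithBot ℕ) := by
  have hDQ : D * Q ^ 2 = P ^ 2 - C 1 := by rw [C_1]; linear_combination -h
  have hdeg : (D * Q ^ 2).natDegree = 2 * n := by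
    rw [hDQ, natDegree_sub_C, natDegree_pow, hP]
  have hne : D * Q ^ 2 ≠ 0 := ne_zero_of_natDegree_gt (n := 0) (by omega)
  have hD0 : D ≠ 0 := left_ne_zero_of_mul hne
  have hQ2 : Q ^ 2 ≠ 0 := right_ne_zero_of_mul hne
  have hQ : Q ≠ 0 := fun hQ => hQ2 (by simp [hQ])
  rw [natDegree_mul hD0 hQ2, natDegree_pow, hD] at hdeg
  rw [degree_eq_natDegree hQ]
  congr 1
  omega

open Polynomial in
/-- Squaring the unit `A + B` of a splitting `A * B = D * Q ^ 2` with `A - B = c`, `c ^ 2 = 1`,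
produces a solution of the Pell equation. -/
theorem exists_pell_of_splitting {K : Type*} [Field K] [NeZero (2 : K)] {D A B Q : K[X]} {c : K}
    {n k : ℕ} (hn : 0 < n) (hA : A.natDegree = n) (hD : D.natDegree = 2 * k) (hc : c ^ 2 = 1)
    (hAB : A - B = C c) (hmul : A * B = D * Q ^ 2) :
    ∃ P R : K[X], P.degree = (n : WithBot ℕ) ∧ R.degree = ((n - k : ℕ) : WithBot ℕ) ∧
      P ^ 2 - D * R ^ 2 = 1 := by
  have hc' : (C c) ^ 2 = (1 : K[X]) := by rw [← C_pow, hc, C_1]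
  have hP : (C 2 * A - C c).natDegree = n := by
    rw [natDegree_sub_C, natDegree_C_mul (NeZero.ne (2 : K)), hA]
  have hpell : (C 2 * A - C c) ^ 2 - D * (C 2 * Q) ^ 2 = 1 := by
    rw [show (C 2 : K[X]) = 2 from rfl]
    linear_combination hc' + 4 * A * hAB + 4 * hmul
  refine ⟨C 2 * A - C c, C 2 * Q, ?_, degree_of_pell hn hP hD hpell, hpell⟩
  rw [degree_eq_natDegree (ne_zero_of_natDegree_gt (n := 0) (by omega)), hP]


/-- Pell equation for periodic trajectories: if one of the four polynomial
functional equations corresponding to `n`-periodicity holds, then there exist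
real polynomials `p̂, q̂` of degrees exactly `n` and `n−3` satisfying the Pell
equation `p̂² − D·q̂² = 1` with
`D(s) = s(s−1/a₁)(s−1/a₂)(s+1/a₃)(s−1/γ₁)(s−1/γ₂)`. -/
theorem pell_equation_for_periodic_trajectories
    (a₁ a₂ a₃ γ₁ γ₂ ε : ℝ)
    (h12 : a₁ > a₂) (h2 : a₂ > 0) (h3 : a₃ > 0)
    (hγ₁ : γ₁ ≠ 0) (hγ₂ : γ₂ ≠ 0)
    (hdist : List.Pairwise (· ≠ ·) [a₁, a₂, -a₃, γ₁, γ₂])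
    (hε : ε = Real.sign (γ₁ * γ₂))
    (n : ℕ) (hn : 4 ≤ n)
    (h :
      (∃ m : ℕ, n = 2 * m ∧ ∃ p q : Polynomial ℝ,
        p.degree = (m : WithBot ℕ) ∧ q.degree = ((m - 3 : ℕ) : WithBot ℕ) ∧
        ∀ s : ℝ, p.eval s ^ 2 -
          s * (s - 1 / a₁) * (s - 1 / a₂) * (s + 1 / a₃) *
            (s - 1 / γ₁) * (s - 1 / γ₂) * q.eval s ^ 2 = 1) ∨
      (∃ m : ℕ, n = 2 * m ∧ ∃ p q : Polynomial ℝ,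
        p.degree = ((m - 1 : ℕ) : WithBot ℕ) ∧ q.degree = ((m - 2 : ℕ) : WithBot ℕ) ∧
        ∀ s : ℝ, (s - 1 / γ₁) * (s - 1 / γ₂) * p.eval s ^ 2 -
          s * (s - 1 / a₁) * (s - 1 / a₂) * (s + 1 / a₃) * q.eval s ^ 2 = ε) ∨
      (∃ m : ℕ, n = 2 * m + 1 ∧ ∃ p q : Polynomial ℝ,
        p.degree = (m : WithBot ℕ) ∧ q.degree = ((m - 2 : ℕ) : WithBot ℕ) ∧
        ∀ s : ℝ, (s - 1 / γ₁) * p.eval s ^ 2 -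
          s * (s - 1 / a₁) * (s - 1 / a₂) * (s + 1 / a₃) *
            (s - 1 / γ₂) * q.eval s ^ 2 = -1) ∨
      (∃ m : ℕ, n = 2 * m + 1 ∧ ∃ p q : Polynomial ℝ,
        p.degree = (m : WithBot ℕ) ∧ q.degree = ((m - 2 : ℕ) : WithBot ℕ) ∧
        ∀ s : ℝ, (s - 1 / γ₂) * p.eval s ^ 2 -
          s * (s - 1 / a₁) * (s - 1 / a₂) * (s + 1 / a₃) *
            (s - 1 / γ₁) * q.eval s ^ 2 = 1)) :
    ∃ phat qhat : Polynomial ℝ,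
      phat.degree = (n : WithBot ℕ) ∧ qhat.degree = ((n - 3 : ℕ) : WithBot ℕ) ∧
      ∀ s : ℝ, phat.eval s ^ 2 -
        s * (s - 1 / a₁) * (s - 1 / a₂) * (s + 1 / a₃) *
          (s - 1 / γ₁) * (s - 1 / γ₂) * qhat.eval s ^ 2 = 1 := by
  set D : Polynomial ℝ := .X * (.X - .C (1 / a₁)) * (.X - .C (1 / a₂)) * (.X + .C (1 / a₃)) *
    (.X - .C (1 / γ₁)) * (.X - .C (1 / γ₂)) with hDdef
  have hD : D.natDegree = 2 * 3 := by rw [hDdef]; compute_degree!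
  suffices H : ∃ (A B Q : Polynomial ℝ) (c : ℝ), A.natDegree = n ∧ c ^ 2 = 1 ∧
      A - B = .C c ∧ A * B = D * Q ^ 2 by
    obtain ⟨A, B, Q, c, hA, hc, hAB, hmul⟩ := H
    obtain ⟨P, R, hP, hR, hpell⟩ :=
      exists_pell_of_splitting (by omega) hA hD hc hAB hmul
    refine ⟨P, R, hP, hR, fun s => ?_⟩
    simpa [hDdef] using congrArg (Polynomial.eval s) hpell
  rcases h with ⟨m, hm, p, q, hp, -, h⟩ | ⟨m, hm, p, q, hp, -, h⟩ | ⟨m, hm, p, q, hp, -, h⟩ |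
    ⟨m, hm, p, q, hp, -, h⟩
  all_goals
    have hp0 : p ≠ 0 := by rintro rfl; simp at hp
    have hp2 : p ^ 2 ≠ 0 := pow_ne_zero 2 hp0
    have hpd := Polynomial.natDegree_eq_of_degree_eq_some hp
  · refine ⟨p ^ 2, D * q ^ 2, p * q, 1, ?_, by norm_num, ?_, by ring⟩
    · rw [Polynomial.natDegree_pow, hpd, hm]
    · refine Polynomial.funext fun s => ?_
      simpa [hDdef] using h s
  · have hε2 : ε ^ 2 = 1 := by
      rcases (mul_ne_zero hγ₁ hγ₂).lt_or_gt with hs | hs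
      · rw [hε, Real.sign_of_neg hs]; norm_num
      · rw [hε, Real.sign_of_pos hs]; norm_num
    refine ⟨(.X - .C (1 / γ₁)) * (.X - .C (1 / γ₂)) * p ^ 2,
      .X * (.X - .C (1 / a₁)) * (.X - .C (1 / a₂)) * (.X + .C (1 / a₃)) * q ^ 2, p * q, ε, ?_,
      hε2, ?_, by ring⟩
    · have h₁ := Polynomial.X_sub_C_ne_zero (1 / γ₁)
      have h₂ := Polynomial.X_sub_C_ne_zero (1 / γ₂)
      rw [Polynomial.natDegree_mul (mul_ne_zero h₁ h₂) hp2, Polynomial.natDegree_mul h₁ h₂,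
        Polynomial.natDegree_X_sub_C, Polynomial.natDegree_X_sub_C, Polynomial.natDegree_pow, hpd]
      omega
    · refine Polynomial.funext fun s => ?_
      simpa using h s
  · refine ⟨(.X - .C (1 / γ₁)) * p ^ 2,
      .X * (.X - .C (1 / a₁)) * (.X - .C (1 / a₂)) * (.X + .C (1 / a₃)) *
        (.X - .C (1 / γ₂)) * q ^ 2, p * q, -1, ?_, by norm_num, ?_, by ring⟩
    · rw [Polynomial.natDegree_mul (Polynomial.X_sub_C_ne_zero _) hp2,
        Polynomial.natDegree_X_sub_C, Polynomial.natDegree_pow, hpd]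
      omega
    · refine Polynomial.funext fun s => ?_
      simpa using h s
  · refine ⟨(.X - .C (1 / γ₂)) * p ^ 2,
      .X * (.X - .C (1 / a₁)) * (.X - .C (1 / a₂)) * (.X + .C (1 / a₃)) *
        (.X - .C (1 / γ₁)) * q ^ 2, p * q, 1, ?_, by norm_num, ?_, by ring⟩
    · rw [Polynomial.natDegree_mul (Polynomial.X_sub_C_ne_zero _) hp2,
        Polynomial.natDegree_X_sub_C, Polynomial.natDegree_pow, hpd]
      omega
    · refine Polynomial.funext fun s => ?_
      simpa using h s
end

section
/- (Doubling construction for Pell-type polynomial equations.) Let F, E, p, q be real polynomials in one variable and let δ ∈ {−1, 1} satisfy F·p² − E·q² = δ. Then (2F·p² − δ)² − F·E·(2pq)² = 1. Moreover, if F·p² is not constant, then deg(2F·p² − δ) = deg F + 2·deg p and, if p, q ≠ 0, deg(2pq) = deg p + deg q. -/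
/-- Doubling construction for Pell-type polynomial equations: from a solution of
`F·p² − E·q² = δ` with `δ = ±1`, the pair `(2F·p² − δ, 2pq)` solves the Pell
equation for `D = F·E`, with the expected degrees. -/
theorem pell_doubling_construction
    (F E p q : Polynomial ℝ) (δ : ℝ) (hδ : δ = 1 ∨ δ = -1)
    (h : F * p ^ 2 - E * q ^ 2 = Polynomial.C δ) :
    (2 * F * p ^ 2 - Polynomial.C δ) ^ 2 - F * E * (2 * p * q) ^ 2 = 1 ∧
    ((F * p ^ 2).natDegree ≠ 0 →
      (2 * F * p ^ 2 - Polynomial.C δ).natDegree = F.natDegree + 2 * p.natDegree) ∧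
    (p ≠ 0 → q ≠ 0 → (2 * p * q).natDegree = p.natDegree + q.natDegree) := by
  have two_eq : (2 : Polynomial ℝ) = Polynomial.C 2 := rfl
  have hC : (Polynomial.C δ) ^ 2 = 1 := by
    rcases hδ with rfl | rfl <;> simp
  refine ⟨by linear_combination 4 * F * p ^ 2 * h + hC, fun hdeg => ?_, fun hp hq => ?_⟩
  · have hFp : F * p ^ 2 ≠ 0 := fun h0 => hdeg (by simp [h0])
    rw [Polynomial.natDegree_sub_C, mul_assoc, two_eq,
      Polynomial.natDegree_C_mul two_ne_zero,
      Polynomial.natDegree_mul (left_ne_zero_of_mul hFp) (right_ne_zero_of_mul hFp),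
      Polynomial.natDegree_pow]
  · rw [mul_assoc, two_eq, Polynomial.natDegree_C_mul two_ne_zero,
      Polynomial.natDegree_mul hp hq]
end
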